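/- arXiv:2602.15403 — 2 statements merged into one kernel-verified Lean document; each statement's English description precedes it below -/
import Mathlib

section
/- For every n ≥ 2, the axiom system CB_n is sound with respect to the class of KD45_n models: every formula derivable in CB_n is satisfied at every state of every KD45 model for n agents. -/
/-- Formulas of the language `L_C`: atoms, negation, conjunction, common belief `C`. -/
inductive Formula : Type where
  | atom : ℕ → Formula
  | neg  : Formula → Formula
  | and  : Formula → Formula → Formula
  | box  : Formula → Formula

namespace Formula

/-- Implication `φ → ψ` as a derived connective. -/
def imp (φ ψ : Formula) : Formula := neg (and φ (neg ψ))

/-- Disjunction `φ ∨ ψ` as a derived connective. -/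
def or (φ ψ : Formula) : Formula := neg (and (neg φ) (neg ψ))

/-- The diamond `Ĉφ = ¬C¬φ`. -/
def dia (φ : Formula) : Formula := neg (box (neg φ))

/-- A fixed contradiction (used as the empty disjunction). -/
def bot : Formula := and (atom 0) (neg (atom 0))

/-- A fixed tautology (used as the empty conjunction). -/
def top : Formula := neg bot

end Formula

/-- Finite disjunction of a list of formulas. -/
def bigOr (l : List Formula) : Formula := l.foldr Formula.or Formula.bot

/-- Finite conjunction of a list of formulas. -/
def bigAnd (l : List Formula) : Formula := l.foldr Formula.and Formula.top

/-- The list of pairs `(i, j)` with `i < j` in `Fin m`. -/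
def pairs (m : ℕ) : List (Fin m × Fin m) :=
  ((List.finRange m).product (List.finRange m)).filter (fun p => decide (p.1 < p.2))

/-- A Kripke model for `n` agents. -/
structure Model (n : ℕ) where
  W : Type
  nonempty : Nonempty W
  R : Fin n → W → W → Prop
  V : ℕ → W → Prop

/-- `R*`: the transitive closure of the union of the agents' relations. -/
def Model.star {n : ℕ} (M : Model n) : M.W → M.W → Prop :=
  Relation.TransGen (fun x y => ∃ i, M.R i x y)

/-- Satisfaction: `C` quantifies over `R*`-successors. -/
def Sat {n : ℕ} (M : Model n) : M.W → Formula → Prop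
  | s, .atom p => M.V p s
  | s, .neg φ => ¬ Sat M s φ
  | s, .and φ ψ => Sat M s φ ∧ Sat M s ψ
  | s, .box φ => ∀ t, M.star s t → Sat M t φ

/-- A relation is serial if every point has a successor. -/
def Serial {W : Type} (R : W → W → Prop) : Prop := ∀ x, ∃ y, R x y

/-- A relation is Euclidean if `R x y` and `R x z` imply `R y z`. -/
def Euclidean {W : Type} (R : W → W → Prop) : Prop := ∀ x y z, R x y → R x z → R y z

/-- A KD45 model: all agents' relations are serial, transitive and Euclidean. -/
def KD45 {n : ℕ} (M : Model n) : Prop :=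
  ∀ i, Serial (M.R i) ∧ Transitive (M.R i) ∧ Euclidean (M.R i)

/-- `φ` is an instance of a propositional tautology: it is true under every
assignment of truth values to formulas that respects negation and conjunction. -/
def Tautology (φ : Formula) : Prop :=
  ∀ v : Formula → Prop,
    (∀ ψ, v ψ.neg ↔ ¬ v ψ) →
    (∀ ψ χ, v (ψ.and χ) ↔ (v ψ ∧ v χ)) →
    v φ

/-- The axiom `Cn`: `(C ⋀_{i<j}(Cφᵢ ∨ Cφⱼ)) → ⋁_i Cφᵢ`, for `n+1` formulas. -/
def CnAx (n : ℕ) (φ : Fin (n + 1) → Formula) : Formula :=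
  ((bigAnd ((pairs (n + 1)).map (fun p => Formula.or ((φ p.1).box) ((φ p.2).box)))).box).imp
    (bigOr ((List.finRange (n + 1)).map (fun i => (φ i).box)))

/-- The axiom `Ĉn`: `(⋀_i Ĉφᵢ) → Ĉ(⋁_{i<j}(Ĉφᵢ ∧ Ĉφⱼ))`, for `n+1` formulas. -/
def CHatNAx (n : ℕ) (φ : Fin (n + 1) → Formula) : Formula :=
  (bigAnd ((List.finRange (n + 1)).map (fun i => (φ i).dia))).imp
    ((bigOr ((pairs (n + 1)).map (fun p => ((φ p.1).dia).and ((φ p.2).dia)))).dia)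

/-- The Hilbert system `CB_n`: Prop, K, D, 4, Cc, Cn, with modus ponens and necessitation. -/
inductive CB (n : ℕ) : Formula → Prop
  | taut {φ : Formula} : Tautology φ → CB n φ
  | K (φ ψ : Formula) : CB n (((φ.imp ψ).box).imp ((φ.box).imp (ψ.box)))
  | D (φ : Formula) : CB n ((φ.box).imp (((φ.neg).box).neg))
  | four (φ : Formula) : CB n ((φ.box).imp ((φ.box).box))
  | Cc (φ : Formula) : CB n (((φ.box).imp φ).box)
  | Cn (φ : Fin (n + 1) → Formula) : CB n (CnAx n φ)
  | mp {φ ψ : Formula} : CB n (φ.imp ψ) → CB n φ → CB n ψ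
  | nec {φ : Formula} : CB n φ → CB n (φ.box)

section Semantics

variable {n : ℕ} {M : Model n} {s t u : M.W}

theorem sat_neg {φ : Formula} : Sat M s φ.neg ↔ ¬ Sat M s φ := by
  simp only [Sat]

theorem sat_and {φ ψ : Formula} : Sat M s (φ.and ψ) ↔ Sat M s φ ∧ Sat M s ψ := by
  simp only [Sat]

theorem sat_box {φ : Formula} : Sat M s φ.box ↔ ∀ t, M.star s t → Sat M t φ := by
  simp only [Sat]

theorem sat_imp {φ ψ : Formula} : Sat M s (φ.imp ψ) ↔ (Sat M s φ → Sat M s ψ) := by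
  simp only [Formula.imp, sat_neg, sat_and]
  tauto

theorem sat_or {φ ψ : Formula} : Sat M s (φ.or ψ) ↔ Sat M s φ ∨ Sat M s ψ := by
  simp only [Formula.or, sat_neg, sat_and]
  tauto

theorem sat_top : Sat M s Formula.top := by
  simp only [Formula.top, Formula.bot, sat_neg, sat_and]
  tauto

theorem not_sat_bot : ¬ Sat M s Formula.bot := by
  simp only [Formula.bot, sat_neg, sat_and]
  tauto

theorem sat_bigAnd {l : List Formula} : Sat M s (bigAnd l) ↔ ∀ φ ∈ l, Sat M s φ := by
  induction l with
  | nil => simp [bigAnd, sat_top]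
  | cons φ l ih =>
    rw [List.forall_mem_cons, ← ih]
    exact sat_and

theorem sat_bigOr {l : List Formula} : Sat M s (bigOr l) ↔ ∃ φ ∈ l, Sat M s φ := by
  induction l with
  | nil => simp [bigOr, not_sat_bot]
  | cons φ l ih =>
    rw [List.exists_mem_cons_iff, ← ih]
    exact sat_or

theorem mem_pairs {m : ℕ} {p : Fin m × Fin m} : p ∈ pairs m ↔ p.1 < p.2 := by
  rw [pairs, List.mem_filter, decide_eq_true_iff]
  exact and_iff_right (List.mem_product.2 ⟨List.mem_finRange _, List.mem_finRange _⟩)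

theorem KD45.exists_star (hM : KD45 M) (i : Fin n) (s : M.W) : ∃ t, M.star s t :=
  let ⟨t, ht⟩ := (hM i).1 s
  ⟨t, .single ⟨i, ht⟩⟩

/-- Every `R*`-successor is `R*`-reflexive. -/
theorem KD45.star_refl_of_star (hM : KD45 M) (h : M.star s t) : M.star t t := by
  obtain ⟨u, -, i, hi⟩ := Relation.TransGen.tail'_iff.1 h
  exact .single ⟨i, (hM i).2.2 u t t hi hi⟩

theorem sat_CnAx (hM : KD45 M) (φ : Fin (n + 1) → Formula) : Sat M s (CnAx n φ) := by
  simp only [CnAx, sat_imp, sat_bigOr, sat_box, sat_bigAnd, List.forall_mem_map, sat_or,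
    mem_pairs, Prod.forall]
  intro h
  by_contra! hne
  have hw : ∀ i, ∃ (a : Fin n) (u t : M.W), M.R a s u ∧
      Relation.ReflTransGen (fun x y => ∃ i, M.R i x y) u t ∧ ¬ Sat M t (φ i) := by
    intro i
    have hi := hne _ (List.mem_map_of_mem (List.mem_finRange i))
    simp only [sat_box, not_forall] at hi
    obtain ⟨t, hst, ht⟩ := hi
    obtain ⟨u, ⟨a, hsu⟩, hut⟩ := Relation.TransGen.head'_iff.1 hst
    exact ⟨a, u, t, hsu, hut, ht⟩
  choose a u t hsu hut ht using hw
  obtain ⟨i, j, hij, haij⟩ : ∃ i j, i < j ∧ a i = a j := by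
    obtain ⟨i, j, hij, haij⟩ := Fintype.exists_ne_map_eq_of_card_lt a (by simp)
    rcases hij.lt_or_gt with hlt | hlt
    · exact ⟨i, j, hlt, haij⟩
    · exact ⟨j, i, hlt, haij.symm⟩
  have reach : ∀ k, a k = a i → M.star (u i) (t k) := fun k hk =>
    .head' ⟨a i, (hM (a i)).2.2 s _ _ (hsu i) (hk ▸ hsu k)⟩ (hut k)
  rcases h (u i) (.single ⟨a i, hsu i⟩) i j hij with hi | hj
  · exact ht i (hi _ (reach i rfl))
  · exact ht j (hj _ (reach j haij.symm))

end Semantics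

/-- Soundness of `CB_n` (`n ≥ 2`) with respect to the class of KD45 models
for `n` agents. -/
theorem CB_sound :
    ∀ n : ℕ, 2 ≤ n → ∀ φ : Formula, CB n φ →
      ∀ M : Model n, KD45 M → ∀ s : M.W, Sat M s φ := by
  intro n hn φ h M hM
  induction h with
  | taut h => exact fun s => h (Sat M s) (fun _ => sat_neg) fun _ _ => sat_and
  | K φ ψ =>
    simp only [sat_imp, sat_box]
    exact fun s h₁ h₂ t ht => h₁ t ht (h₂ t ht)
  | D φ =>
    simp only [sat_imp, sat_box, sat_neg]
    intro s h₁ h₂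
    obtain ⟨t, ht⟩ := hM.exists_star ⟨0, by omega⟩ s
    exact h₂ t ht (h₁ t ht)
  | four φ =>
    simp only [sat_imp, sat_box]
    exact fun s h t ht u hu => h u (ht.trans hu)
  | Cc φ =>
    simp only [sat_imp, sat_box]
    exact fun s t ht h => h t (hM.star_refl_of_star ht)
  | Cn φ => exact fun s => sat_CnAx hM φ
  | mp _ _ ih₁ ih₂ => exact fun s => sat_imp.1 (ih₁ s) (ih₂ s)
  | nec _ ih => exact fun s => sat_box.2 fun t _ => ih t
end

section
/- The axiom Ĉ2 is not derivable in the system KD4Cc: there exist formulas φ_1, φ_2, φ_3 of L_C such that the formula (Ĉφ_1 ∧ Ĉφ_2 ∧ Ĉφ_3) → Ĉ((Ĉφ_1 ∧ Ĉφ_2) ∨ (Ĉφ_1 ∧ Ĉφ_3) ∨ (Ĉφ_2 ∧ Ĉφ_3)) is not derivable in the Hilbert system with axioms Prop, K, D, 4, Cc and rules modus ponens and necessitation. Consequently KD4Cc is not a complete axiomatisation of common belief over KD45_2 models. -/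
/-- The Hilbert system `KD4Cc`: Prop, K, D, 4, Cc, with modus ponens and necessitation. -/
inductive KD4Cc : Formula → Prop
  | taut {φ : Formula} : Tautology φ → KD4Cc φ
  | K (φ ψ : Formula) : KD4Cc (((φ.imp ψ).box).imp ((φ.box).imp (ψ.box)))
  | D (φ : Formula) : KD4Cc ((φ.box).imp (((φ.neg).box).neg))
  | four (φ : Formula) : KD4Cc ((φ.box).imp ((φ.box).box))
  | Cc (φ : Formula) : KD4Cc (((φ.box).imp φ).box)
  | mp {φ ψ : Formula} : KD4Cc (φ.imp ψ) → KD4Cc φ → KD4Cc ψ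
  | nec {φ : Formula} : KD4Cc φ → KD4Cc (φ.box)

section

variable {n : ℕ} {M : Model n} {s t : M.W} {φ ψ : Formula}

namespace Sat

@[simp] theorem neg_iff : Sat M s φ.neg ↔ ¬ Sat M s φ := Iff.rfl

@[simp] theorem and_iff : Sat M s (φ.and ψ) ↔ Sat M s φ ∧ Sat M s ψ := Iff.rfl

@[simp] theorem box_iff : Sat M s φ.box ↔ ∀ t, M.star s t → Sat M t φ := Iff.rfl

@[simp] theorem imp_iff : Sat M s (φ.imp ψ) ↔ (Sat M s φ → Sat M s ψ) := by
  simp [Formula.imp]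

@[simp] theorem or_iff : Sat M s (φ.or ψ) ↔ Sat M s φ ∨ Sat M s ψ := by
  simp only [Formula.or, neg_iff, and_iff]
  tauto

@[simp] theorem dia_iff : Sat M s φ.dia ↔ ∃ t, M.star s t ∧ Sat M t φ := by
  simp [Formula.dia]

end Sat

namespace KD45

theorem star_shift_refl (hM : KD45 M) (h : M.star s t) : M.star t t := by
  obtain ⟨u, -, i, hi⟩ := Relation.TransGen.tail'_iff.mp h
  exact .single ⟨i, (hM i).2.2 _ _ _ hi hi⟩

theorem exists_star_s6 [NeZero n] (hM : KD45 M) (s : M.W) : ∃ t, M.star s t := by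
  obtain ⟨t, ht⟩ := (hM 0).1 s
  exact ⟨t, .single ⟨0, ht⟩⟩

/-- If `t` is reachable from `s`, then it is reachable from every successor of `s` for the
agent who takes the first step of a path from `s` to `t`. -/
theorem exists_agent_star (hM : KD45 M) (h : M.star s t) :
    ∃ i u, M.R i s u ∧ ∀ v, M.R i s v → M.star v t := by
  obtain ⟨u, ⟨i, hi⟩, hut⟩ := Relation.TransGen.head'_iff.mp h
  exact ⟨i, u, hi, fun v hv => .head' ⟨i, (hM i).2.2 _ _ _ hv hi⟩ hut⟩

end KD45

/-- The system `KD4Cc` is sound for KD45 models with at least one agent. -/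
theorem KD4Cc.sound [NeZero n] (hM : KD45 M) (h : KD4Cc φ) : ∀ s, Sat M s φ := by
  induction h with
  | taut h => exact fun s => h (Sat M s) (fun _ => Iff.rfl) (fun _ _ => Iff.rfl)
  | K φ ψ =>
    simp only [Sat.imp_iff, Sat.box_iff]
    exact fun s h h' t ht => h t ht (h' t ht)
  | D φ =>
    simp only [Sat.imp_iff, Sat.box_iff, Sat.neg_iff]
    intro s h h'
    obtain ⟨t, ht⟩ := hM.exists_star_s6 s
    exact h' t ht (h t ht)
  | four φ =>
    simp only [Sat.imp_iff, Sat.box_iff]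
    exact fun s h t ht u hu => h u (ht.trans hu)
  | Cc φ =>
    simp only [Sat.imp_iff, Sat.box_iff]
    exact fun s t ht h => h t (hM.star_shift_refl ht)
  | mp _ _ ih ih' => exact fun s => Sat.imp_iff.mp (ih s) (ih' s)
  | nec _ ih => exact fun s t _ => ih t

/-- The axiom `Ĉ2` for three formulas. -/
def CHat2 (φ₁ φ₂ φ₃ : Formula) : Formula :=
  ((φ₁.dia).and ((φ₂.dia).and (φ₃.dia))).imp
    ((Formula.or ((φ₁.dia).and (φ₂.dia))
      (Formula.or ((φ₁.dia).and (φ₃.dia)) ((φ₂.dia).and (φ₃.dia)))).dia)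

theorem CHat2.sat {M : Model 2} (hM : KD45 M) (s : M.W) (φ₁ φ₂ φ₃ : Formula) :
    Sat M s (CHat2 φ₁ φ₂ φ₃) := by
  simp only [CHat2, Sat.imp_iff, Sat.and_iff, Sat.dia_iff, Sat.or_iff]
  rintro ⟨⟨a, ha, h₁⟩, ⟨b, hb, h₂⟩, c, hc, h₃⟩
  obtain ⟨i, u, hu, hi⟩ := hM.exists_agent_star ha
  obtain ⟨j, v, hv, hj⟩ := hM.exists_agent_star hb
  obtain ⟨k, w, hw, hk⟩ := hM.exists_agent_star hc
  have : i = j ∨ i = k ∨ j = k := by omega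
  rcases this with rfl | rfl | rfl
  · exact ⟨u, .single ⟨i, hu⟩, .inl ⟨⟨a, hi u hu, h₁⟩, b, hj u hu, h₂⟩⟩
  · exact ⟨u, .single ⟨i, hu⟩, .inr (.inl ⟨⟨a, hi u hu, h₁⟩, c, hk u hu, h₃⟩)⟩
  · exact ⟨v, .single ⟨j, hv⟩, .inr (.inr ⟨⟨b, hj v hv, h₂⟩, c, hk v hv, h₃⟩)⟩

/-- The model with a root `none` at which agent `i` considers only `some i` possible, each
`some i` being seen only by itself and being the only point where atom `i` holds. -/
def fork (n : ℕ) : Model n where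
  W := Option (Fin n)
  nonempty := ⟨none⟩
  R i x y := y = some (x.getD i)
  V p x := ∃ i : Fin n, i.val = p ∧ x = some i

namespace fork

theorem kd45 (n : ℕ) : KD45 (fork n) := by
  refine fun i => ⟨fun x => ⟨_, rfl⟩, ?_, ?_⟩
  · rintro x _ _ rfl rfl
    rfl
  · rintro x _ _ rfl rfl
    rfl

theorem star_none (i : Fin n) : (fork n).star none (some i) := .single ⟨i, rfl⟩

theorem eq_of_star_some {i : Fin n} {x : (fork n).W} (h : (fork n).star (some i) x) :
    x = some i := by
  induction h with
  | single h =>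
    obtain ⟨_, rfl⟩ := h
    rfl
  | tail _ h ih =>
    subst ih
    obtain ⟨_, rfl⟩ := h
    rfl

theorem exists_eq_some_of_star {x y : (fork n).W} (h : (fork n).star x y) :
    ∃ i, y = some i := by
  obtain ⟨u, -, i, hi⟩ := Relation.TransGen.tail'_iff.mp h
  exact ⟨_, hi⟩

theorem sat_dia_atom_some {i : Fin n} {p : ℕ} :
    Sat (fork n) (some i) (Formula.atom p).dia → i.val = p := by
  intro h
  obtain ⟨t, ht, j, rfl, hj⟩ := Sat.dia_iff.mp h
  rw [eq_of_star_some ht] at hj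
  rw [Option.some.inj hj]

theorem sat_dia_atom_none (i : Fin n) : Sat (fork n) none (Formula.atom i).dia :=
  Sat.dia_iff.mpr ⟨some i, star_none i, i, rfl, rfl⟩

theorem not_sat_CHat2 : ¬ Sat (fork 3) none (CHat2 (.atom 0) (.atom 1) (.atom 2)) := by
  intro h
  obtain ⟨t, ht, h⟩ := Sat.dia_iff.mp (Sat.imp_iff.mp h
    ⟨sat_dia_atom_none 0, sat_dia_atom_none 1, sat_dia_atom_none 2⟩)
  rw [Sat.or_iff, Sat.or_iff] at h
  obtain ⟨i, rfl⟩ := exists_eq_some_of_star ht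
  rcases h with ⟨h, h'⟩ | ⟨h, h'⟩ | ⟨h, h'⟩ <;>
  · have := sat_dia_atom_some h
    have := sat_dia_atom_some h'
    omega

end fork

theorem not_KD4Cc_CHat2 : ¬ KD4Cc (CHat2 (.atom 0) (.atom 1) (.atom 2)) :=
  fun h => fork.not_sat_CHat2 (h.sound (fork.kd45 3) none)

end

/-- `Ĉ2` is not derivable in `KD4Cc`; consequently `KD4Cc` is not a complete
axiomatisation of common belief over KD45 models for 2 agents. -/
theorem CHat2_not_derivable_KD4Cc :
    (∃ φ₁ φ₂ φ₃ : Formula,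
      ¬ KD4Cc (((φ₁.dia).and ((φ₂.dia).and (φ₃.dia))).imp
        ((Formula.or ((φ₁.dia).and (φ₂.dia))
          (Formula.or ((φ₁.dia).and (φ₃.dia)) ((φ₂.dia).and (φ₃.dia)))).dia))) ∧
    (∃ φ : Formula, (∀ M : Model 2, KD45 M → ∀ s : M.W, Sat M s φ) ∧ ¬ KD4Cc φ) := by
  exact ⟨⟨_, _, _, not_KD4Cc_CHat2⟩, _, fun _ hM s => CHat2.sat hM s _ _ _, not_KD4Cc_CHat2⟩
end
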